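/- For every ε > 0 there exists p₀ such that for every prime p ≥ p₀ and every set A ⊆ (ZMod p) \ {0} which is sum-free (i.e. A ∩ (A + A) = ∅) and satisfies A = A*, one has |A| ≤ (1/9 + ε)·p, where A* := {a⁻¹ : a ∈ A}. -/

import Mathlib

open Finset
open scoped Classical Pointwise

noncomputable section

/-- Set of multiplicative inverses. -/
def inv' {p : ℕ} (A : Finset (ZMod p)) : Finset (ZMod p) := A.image (fun x => x⁻¹)

/-! ### The theorem of Pollard -/

/-- number of representations of `x` as a sum -/
def repr2 {p : ℕ} (A B : Finset (ZMod p)) (x : ZMod p) : ℕ := (A.filter (fun a => x - a ∈ B)).card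

lemma repr2_comm {p : ℕ} (A B : Finset (ZMod p)) (x : ZMod p) : repr2 A B x = repr2 B A x := by
  unfold repr2
  apply Finset.card_bij' (fun a _ => x - a) (fun a _ => x - a) <;> simp +contextual

lemma repr2_union_left {p : ℕ} (A B C : Finset (ZMod p)) (h : Disjoint A B) (x : ZMod p) :
    repr2 (A ∪ B) C x = repr2 A C x + repr2 B C x := by
  unfold repr2
  rw [Finset.filter_union, Finset.card_union_of_disjoint]
  exact Finset.disjoint_filter_filter h

lemma repr2_union_right {p : ℕ} (A B C : Finset (ZMod p)) (h : Disjoint A B) (x : ZMod p) :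
    repr2 C (A ∪ B) x = repr2 C A x + repr2 C B x := by
  rw [repr2_comm, repr2_union_left _ _ _ h, repr2_comm A, repr2_comm B]

lemma repr2_le_right {p : ℕ} (A B : Finset (ZMod p)) (x : ZMod p) : repr2 A B x ≤ B.card := by
  rw [repr2_comm]; exact Finset.card_filter_le _ _

lemma sum_repr2 {p : ℕ} [NeZero p] (A B : Finset (ZMod p)) :
    ∑ x, repr2 A B x = A.card * B.card := by
  unfold repr2
  simp_rw [Finset.card_filter]
  rw [Finset.sum_comm]
  have : ∀ a : ZMod p, ∑ x, (if x - a ∈ B then 1 else 0) = B.card := by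
    intro a
    rw [Fintype.sum_equiv (Equiv.subRight a) (fun x => if x - a ∈ B then 1 else 0)
      (fun x => if x ∈ B then 1 else 0) (by intro x; simp)]
    simp
  simp [this]

lemma repr2_dyson {p : ℕ} (A B : Finset (ZMod p)) (x : ZMod p) :
    repr2 A B x = repr2 (A ∪ B) (A ∩ B) x + repr2 (A \ B) (B \ A) x := by
  have hA : A = (A \ B) ∪ (A ∩ B) := by ext; simp; tauto
  have hB : B = (B \ A) ∪ (A ∩ B) := by ext; simp; tauto
  have hU : A ∪ B = (A \ B) ∪ (B \ A) ∪ (A ∩ B) := by ext; simp; tauto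
  have d1 : Disjoint (A \ B) (A ∩ B) := by
    rw [Finset.disjoint_left]; intro a; simp; tauto
  have d2 : Disjoint (B \ A) (A ∩ B) := by
    rw [Finset.disjoint_left]; intro a; simp; tauto
  have d3 : Disjoint ((A \ B) ∪ (B \ A)) (A ∩ B) := by
    rw [Finset.disjoint_left]; intro a; simp; tauto
  have d4 : Disjoint (A \ B) (B \ A) := by
    rw [Finset.disjoint_left]; intro a; simp; tauto
  have e1 : repr2 A B x = repr2 (A \ B) (B \ A) x + repr2 (A \ B) (A ∩ B) x
      + (repr2 (A ∩ B) (B \ A) x + repr2 (A ∩ B) (A ∩ B) x) := by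
    rw [← repr2_union_right _ _ _ d2, ← repr2_union_right _ _ _ d2, ← hB,
      ← repr2_union_left _ _ _ d1, ← hA]
  rw [e1, hU, repr2_union_left _ _ _ d3, repr2_union_left _ _ _ d4, repr2_comm (A ∩ B) (B \ A)]
  ring

lemma repr2_translate {p : ℕ} (A B : Finset (ZMod p)) (e x : ZMod p) :
    repr2 A (B.image (fun b => b + e)) x = repr2 A B (x - e) := by
  unfold repr2
  congr 1
  ext a
  simp only [mem_filter, mem_image, and_congr_right_iff]
  intro _
  constructor
  · rintro ⟨b, hb, h⟩
    have : x - e - a = b := by rw [sub_right_comm, ← h]; ring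
    rwa [this]
  · intro h
    exact ⟨_, h, by ring⟩

lemma pollard {p : ℕ} [Fact p.Prime] (n : ℕ) : ∀ (A B : Finset (ZMod p)) (t : ℕ), B.card = n →
    t ≤ A.card → t ≤ B.card → A.card + B.card ≤ p + t →
    t * (A.card + B.card) ≤ t * t + ∑ x, min t (repr2 A B x) := by
  induction n using Nat.strong_induction_on with
  | _ n ih =>
  intro A B t hn htA htB hp
  rcases Nat.eq_or_lt_of_le htB with h | h
  · have : ∀ x, min t (repr2 A B x) = repr2 A B x := by
      intro x; apply min_eq_right; rw [h]; exact repr2_le_right _ _ _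
    simp_rw [this]
    rw [sum_repr2, h]
    nlinarith
  rcases Nat.eq_zero_or_pos t with h0 | h0
  · subst h0; simp
  -- find a translate
  have key : ∃ e, (A ∩ B.image (fun b => b + e)).Nonempty ∧ ¬ (B.image (fun b => b + e)) ⊆ A := by
    by_contra hcon
    push Not at hcon
    obtain ⟨a0, ha0⟩ : A.Nonempty := Finset.card_pos.1 (by omega)
    obtain ⟨b0, hb0, b1, hb1, hb⟩ : ∃ b0 ∈ B, ∃ b1 ∈ B, b0 ≠ b1 :=
      Finset.one_lt_card.1 (by omega)
    have step : ∀ a ∈ A, a + (b1 - b0) ∈ A := by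
      intro a ha
      have := hcon (a - b0) ⟨a, by
        simp only [mem_inter, mem_image]
        exact ⟨ha, b0, hb0, by ring⟩⟩
      apply this
      simp only [mem_image]
      exact ⟨b1, hb1, by ring⟩
    have step2 : ∀ k : ℕ, a0 + k * (b1 - b0) ∈ A := by
      intro k
      induction k with
      | zero => simpa using ha0
      | succ k ihk =>
        have := step _ ihk
        convert this using 1
        push_cast; ring
    have hu : A = univ := by
      ext y
      simp only [mem_univ, iff_true]
      have := step2 ((y - a0) / (b1 - b0)).val
      rw [ZMod.natCast_zmod_val, div_mul_cancel₀ _ (sub_ne_zero.2 hb.symm)] at this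
      simpa using this
    rw [hu, Finset.card_univ, ZMod.card] at hp
    omega
  obtain ⟨e, ⟨hne, hns⟩⟩ := key
  set B' := B.image (fun b => b + e) with hB'
  have hcB : B'.card = B.card := Finset.card_image_of_injective _ (add_left_injective e)
  have hsum : ∑ x, min t (repr2 A B x) = ∑ x, min t (repr2 A B' x) := by
    rw [Fintype.sum_equiv (Equiv.subRight e) (fun x => min t (repr2 A B' x))
      (fun x => min t (repr2 A B x))]
    intro x
    rw [hB', repr2_translate]; rfl
  rw [hsum, ← hcB]
  rw [← hcB] at hn htB hp h
  have hi0 : 0 < (A ∩ B').card := Finset.card_pos.2 hne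
  have hi1 : (A ∩ B').card < B'.card := by
    apply Finset.card_lt_card
    refine ⟨Finset.inter_subset_right, fun hh => hns (hh.trans Finset.inter_subset_left)⟩
  have hUI : (A ∪ B').card + (A ∩ B').card = A.card + B'.card := Finset.card_union_add_card_inter _ _
  have hA0 : (A \ B').card + (A ∩ B').card = A.card := Finset.card_sdiff_add_card_inter _ _
  have hB0 : (B' \ A).card + (A ∩ B').card = B'.card := by
    rw [Finset.inter_comm]; exact Finset.card_sdiff_add_card_inter _ _
  rcases le_or_gt t (A ∩ B').card with hti | hti
  · have := ih _ (by omega) (A ∪ B') (A ∩ B') t rfl (by omega) hti (by omega)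
    rw [hUI] at this
    refine this.trans ?_
    gcongr with x
    rw [repr2_dyson A B' x]; omega
  · set i := (A ∩ B').card with hi
    obtain ⟨s, rfl⟩ : ∃ s, t = i + s := ⟨t - i, by omega⟩
    have := ih _ (by omega) (A \ B') (B' \ A) s rfl (by omega) (by omega) (by omega)
    have h2 : ∑ x, repr2 (A ∪ B') (A ∩ B') x + ∑ x, min s (repr2 (A \ B') (B' \ A) x)
        ≤ ∑ x, min (i + s) (repr2 A B' x) := by
      rw [← Finset.sum_add_distrib]
      gcongr with x
      rw [repr2_dyson A B' x]
      have := repr2_le_right (A ∪ B') (A ∩ B') x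
      omega
    rw [sum_repr2] at h2
    have e1 : (A.card : ℤ) = (A \ B').card + i := by exact_mod_cast hA0.symm
    have e2 : (B'.card : ℤ) = (B' \ A).card + i := by exact_mod_cast hB0.symm
    have e3 : ((A ∪ B').card : ℤ) = (A \ B').card + (B' \ A).card + i := by
      have := congrArg (Nat.cast : ℕ → ℤ) hUI
      push_cast at this
      linarith
    rw [← hi] at h2
    zify at h2 this ⊢
    rw [e1, e2]
    rw [e3] at h2
    nlinarith

/-- number of Schur triples -/
def schur {p : ℕ} (S : Finset (ZMod p)) : ℕ := ∑ x ∈ S, repr2 S S x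

lemma schur_bound {p : ℕ} [Fact p.Prime] (S : Finset (ZMod p)) (m t : ℕ) (htm : t ≤ m)
    (hm : m ≤ S.card) (hp : 2 * m ≤ p + t) : t * (3 * m) ≤ t * (t + p) + schur S := by
  obtain ⟨S', hS', rfl⟩ := Finset.exists_subset_card_eq hm
  have h := pollard _ S' S' t rfl htm htm (by omega)
  have h1 : ∑ x, min t (repr2 S' S' x) ≤ t * (p - S'.card) + schur S := by
    rw [← Finset.sum_compl_add_sum S']
    gcongr
    · calc _ ≤ ∑ x ∈ S'ᶜ, t := by gcongr; exact min_le_left _ _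
        _ = _ := by rw [Finset.sum_const, Finset.card_compl, ZMod.card]; simp [mul_comm]
    · unfold schur
      calc _ ≤ ∑ x ∈ S', repr2 S S x := by
            gcongr with x
            refine (min_le_right _ _).trans ?_
            unfold repr2
            apply Finset.card_le_card
            intro a
            simp only [mem_filter]
            exact fun h => ⟨hS' h.1, hS' h.2⟩
        _ ≤ _ := Finset.sum_le_sum_of_subset hS'
  have h3 : S'.card ≤ p := by
    have := Finset.card_le_univ S'
    rwa [ZMod.card] at this
  zify [h3] at h h1 ⊢
  nlinarith

lemma schur_final (ε : ℝ) (hε : 0 < ε) (hε1 : ε ≤ 1 / 10) : ∃ κ : ℝ, 0 < κ ∧ ∃ p₀ : ℕ,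
    ∀ (p : ℕ) [Fact p.Prime], p ≥ p₀ → ∀ S : Finset (ZMod p), (schur S : ℝ) ≤ κ * p ^ 2 →
      (S.card : ℝ) ≤ (1 / 3 + ε) * p := by
  refine ⟨ε ^ 2 / 2, by positivity, ⌈1 / ε⌉₊ + 20, ?_⟩
  intro p _ hp S hS
  by_contra hcon
  push Not at hcon
  have hp1 : 1 / ε ≤ p := (Nat.le_ceil _).trans (by exact_mod_cast (by omega : ⌈1 / ε⌉₊ ≤ p))
  have hp2 : (20 : ℝ) ≤ p := by exact_mod_cast (by omega : 20 ≤ p)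
  have hp3 : 1 ≤ ε * p := by rw [div_le_iff₀ hε] at hp1; linarith
  set m := ⌈(1 / 3 + ε) * p⌉₊ with hm
  set t := ⌈ε * p⌉₊ with ht
  have m1 : (1 / 3 + ε) * p ≤ m := Nat.le_ceil _
  have m2 : (m : ℝ) < (1 / 3 + ε) * p + 1 := Nat.ceil_lt_add_one (by positivity)
  have t1 : ε * p ≤ t := Nat.le_ceil _
  have t2 : (t : ℝ) < ε * p + 1 := Nat.ceil_lt_add_one (by positivity)
  have hεp : ε * p ≤ 1 / 10 * p := by gcongr
  have := schur_bound S m t (by apply Nat.ceil_le_ceil; gcongr; linarith)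
    (Nat.ceil_le.2 hcon.le) (by
      have : (2 * m : ℝ) ≤ p + t := by linarith
      exact_mod_cast this)
  have h4 : (t : ℝ) * (3 * m) ≤ t * (t + p) + schur S := by exact_mod_cast this
  have h5 : ε * p ≤ 3 * m - t - p := by linarith
  have h6 : (ε * p) * (ε * p) ≤ t * (3 * m - t - p) := by gcongr
  nlinarith
/-! ### Kloosterman sums -/

/-- the standard character -/
def ee {p : ℕ} [Fact p.Prime] (x : ZMod p) : ℂ := ZMod.stdAddChar x

section chars
variable {p : ℕ} [Fact p.Prime]

lemma ee_add (x y : ZMod p) : ee (x + y) = ee x * ee y := AddChar.map_add_eq_mul _ _ _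

lemma ee_zero : ee (0 : ZMod p) = 1 := AddChar.map_zero_eq_one _

lemma norm_ee (x : ZMod p) : ‖ee x‖ = 1 := by
  exact AddChar.norm_apply _ _

lemma ee_neg (x : ZMod p) : ee (-x) = (starRingEnd ℂ) (ee x) := by
  have h1 : ee x * ee (-x) = 1 := by rw [← ee_add]; simp [ee_zero]
  have h2 : ee x * (starRingEnd ℂ) (ee x) = 1 := by
    rw [Complex.mul_conj, Complex.normSq_eq_norm_sq, norm_ee]; simp
  have h0 : ee x ≠ 0 := by intro h; rw [h] at h1; simp at h1
  exact mul_left_cancel₀ h0 (h1.trans h2.symm)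

lemma ee_sub (x y : ZMod p) : ee (x - y) = ee x * (starRingEnd ℂ) (ee y) := by
  rw [sub_eq_add_neg, ee_add, ee_neg]

lemma sum_ee (t : ZMod p) : ∑ x, ee (x * t) = if t = 0 then (p : ℂ) else 0 := by
  have := AddChar.sum_mulShift t (ZMod.isPrimitive_stdAddChar p)
  rw [ZMod.card] at this
  unfold ee
  rw [this]
  split_ifs <;> simp

/-- Kloosterman sum -/
def kl (a b : ZMod p) : ℂ := ∑ u : (ZMod p)ˣ, ee (a * (u : ZMod p) + b * ((u⁻¹ : (ZMod p)ˣ) : ZMod p))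

lemma kl_zero : kl (0 : ZMod p) 0 = (p : ℂ) - 1 := by
  unfold kl
  have hp : 1 ≤ p := (Fact.out : p.Prime).one_lt.le
  simp only [zero_mul, add_zero, ee_zero, sum_const, card_univ, nsmul_eq_mul, mul_one]
  rw [ZMod.card_units_eq_totient, Nat.totient_prime (Fact.out : p.Prime), Nat.cast_sub hp]
  simp

lemma kl_shift (a b : ZMod p) (c : (ZMod p)ˣ) :
    kl (a * (c : ZMod p)) (b * ((c⁻¹ : (ZMod p)ˣ) : ZMod p)) = kl a b := by
  unfold kl
  refine Fintype.sum_equiv (Equiv.mulLeft c) _ _ ?_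
  intro u
  simp only [Equiv.coe_mulLeft, mul_inv_rev, Units.val_mul]
  congr 1
  ring

/-- the quadruples counted in the fourth moment -/
def quads (p : ℕ) [Fact p.Prime] :
    Finset (((ZMod p)ˣ × (ZMod p)ˣ) × ((ZMod p)ˣ × (ZMod p)ˣ)) :=
  univ.filter (fun q => (q.1.1 + q.1.2 - q.2.1 - q.2.2 : ZMod p) = 0 ∧
    ((q.1.1⁻¹ : (ZMod p)ˣ) + (q.1.2⁻¹ : (ZMod p)ˣ) - (q.2.1⁻¹ : (ZMod p)ˣ)
      - (q.2.2⁻¹ : (ZMod p)ˣ) : ZMod p) = 0)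

lemma quads_card : (quads p).card ≤ 3 * (p - 1) ^ 2 := by
  have hsub : quads p ⊆ (univ.image (fun q : (ZMod p)ˣ × (ZMod p)ˣ => ((q.1, q.2), (q.1, q.2)))) ∪
      (univ.image (fun q : (ZMod p)ˣ × (ZMod p)ˣ => ((q.1, q.2), (q.2, q.1)))) ∪
      (univ.image (fun q : (ZMod p)ˣ × (ZMod p)ˣ => ((q.1, -q.1), (q.2, -q.2)))) := by
    rintro ⟨⟨x, y⟩, ⟨z, w⟩⟩ h
    simp only [quads, mem_filter, mem_univ, true_and] at h
    obtain ⟨h1, h2⟩ := h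
    simp only [mem_union, mem_image, mem_univ, true_and, Prod.mk.injEq, Prod.exists]
    have hx : (x : ZMod p) ≠ 0 := x.ne_zero
    have hy : (y : ZMod p) ≠ 0 := y.ne_zero
    have hz : (z : ZMod p) ≠ 0 := z.ne_zero
    have hw : (w : ZMod p) ≠ 0 := w.ne_zero
    simp only [Units.val_inv_eq_inv_val] at h2
    have h3 : ((x : ZMod p) + y) * (z * w - x * y) = 0 := by
      field_simp at h2
      have h1' : (w : ZMod p) = x + y - z := by linear_combination -h1
      rw [h1'] at h2 ⊢
      linear_combination h2
    rcases mul_eq_zero.1 h3 with h4 | h4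
    · right
      refine ⟨x, z, ⟨rfl, ?_⟩, rfl, ?_⟩
      · ext; push_cast; linear_combination -h4
      · ext; push_cast; linear_combination -h4 + h1
    · left
      have h5 : ((z : ZMod p) - x) * (z - y) = 0 := by
        linear_combination -h4 - z * h1
      rcases mul_eq_zero.1 h5 with h6 | h6
      · left
        refine ⟨x, y, ⟨rfl, rfl⟩, ?_, ?_⟩
        · ext; linear_combination -h6
        · ext; linear_combination h1 + h6
      · right
        refine ⟨x, y, ⟨rfl, rfl⟩, ?_, ?_⟩
        · ext; linear_combination -h6
        · ext; linear_combination h1 + h6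
  have hc : (univ : Finset ((ZMod p)ˣ × (ZMod p)ˣ)).card = (p - 1) ^ 2 := by
    rw [Finset.card_univ, Fintype.card_prod, ZMod.card_units_eq_totient,
      Nat.totient_prime (Fact.out : p.Prime), sq]
  refine (Finset.card_le_card hsub).trans ?_
  refine (Finset.card_union_le _ _).trans ?_
  have := Finset.card_union_le (univ.image (fun q : (ZMod p)ˣ × (ZMod p)ˣ => ((q.1, q.2), (q.1, q.2))))
      (univ.image (fun q : (ZMod p)ˣ × (ZMod p)ˣ => ((q.1, q.2), (q.2, q.1))))
  have i1 := Finset.card_image_le (s := univ) (f := fun q : (ZMod p)ˣ × (ZMod p)ˣ => ((q.1, q.2), (q.1, q.2)))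
  have i2 := Finset.card_image_le (s := univ) (f := fun q : (ZMod p)ˣ × (ZMod p)ˣ => ((q.1, q.2), (q.2, q.1)))
  have i3 := Finset.card_image_le (s := univ) (f := fun q : (ZMod p)ˣ × (ZMod p)ˣ => ((q.1, -q.1), (q.2, -q.2)))
  rw [hc] at i1 i2 i3
  omega

lemma kl_fourth (a b : ZMod p) : ((‖kl a b‖ ^ 4 : ℝ) : ℂ) =
    ∑ q : ((ZMod p)ˣ × (ZMod p)ˣ) × ((ZMod p)ˣ × (ZMod p)ˣ),
      ee (a * (q.1.1 + q.1.2 - q.2.1 - q.2.2 : ZMod p)) *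
      ee (b * ((q.1.1⁻¹ : (ZMod p)ˣ) + (q.1.2⁻¹ : (ZMod p)ˣ) - (q.2.1⁻¹ : (ZMod p)ˣ)
      - (q.2.2⁻¹ : (ZMod p)ˣ) : ZMod p)) := by
  have h1 : ((‖kl a b‖ ^ 4 : ℝ) : ℂ) = (kl a b * kl a b) *
      ((starRingEnd ℂ) (kl a b) * (starRingEnd ℂ) (kl a b)) := by
    have := Complex.mul_conj' (kl a b)
    push_cast
    linear_combination (-(kl a b * (starRingEnd ℂ) (kl a b)) - (‖kl a b‖ : ℂ) ^ 2) * this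
  rw [h1]
  unfold kl
  rw [map_sum, Finset.sum_mul_sum, Finset.sum_mul_sum, ← Finset.sum_product', ← Finset.sum_product',
    Finset.sum_mul_sum, ← Finset.sum_product']
  simp only [Finset.univ_product_univ]
  apply Finset.sum_congr rfl
  rintro ⟨⟨x, y⟩, ⟨z, w⟩⟩ _
  simp only [← ee_neg, ← ee_add]
  congr 1
  ring

lemma kl_fourth_sum : ∑ a : ZMod p, ∑ b : ZMod p, ‖kl a b‖ ^ 4 ≤ 3 * (p - 1 : ℝ) ^ 2 * p ^ 2 := by
  have hp : 1 ≤ p := (Fact.out : p.Prime).one_lt.le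
  have h : ((∑ a : ZMod p, ∑ b : ZMod p, ‖kl a b‖ ^ 4 : ℝ) : ℂ) = (((quads p).card * p ^ 2 : ℝ) : ℂ) := by
    rw [Complex.ofReal_sum]
    simp_rw [Complex.ofReal_sum, kl_fourth]
    have : ∀ a : ZMod p, ∀ F : _ → ZMod p, ∀ G : _ → ZMod p,
      ∑ b : ZMod p, ∑ q : ((ZMod p)ˣ × (ZMod p)ˣ) × ((ZMod p)ˣ × (ZMod p)ˣ), ee (a * F q) * ee (b * G q)
      = ∑ q, ee (a * F q) * ∑ b, ee (b * G q) := by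
      intro a F G
      rw [Finset.sum_comm]
      simp_rw [Finset.mul_sum]
    simp_rw [this]
    rw [Finset.sum_comm]
    simp_rw [← Finset.sum_mul, sum_ee]
    unfold quads
    rw [Finset.card_filter]
    push_cast
    rw [Finset.sum_mul]
    apply Finset.sum_congr rfl
    intro q _
    split_ifs <;> first | (exfalso; tauto) | simp [sq]
  have h' := Complex.ofReal_injective h
  rw [h']
  gcongr
  have := quads_card (p := p)
  have h2 : ((quads p).card : ℝ) ≤ ((3 * (p - 1) ^ 2 : ℕ) : ℝ) := by exact_mod_cast this
  push_cast [Nat.cast_sub hp] at h2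
  exact h2

lemma kl_bound (a b : ZMod p) (hab : ¬ (a = 0 ∧ b = 0)) : ‖kl a b‖ ^ 4 ≤ 3 * (p : ℝ) ^ 3 := by
  have hp : 1 < p := (Fact.out : p.Prime).one_lt
  have hp' : (1 : ℝ) < p := by exact_mod_cast hp
  have h1 : ∑ c : (ZMod p)ˣ, ‖kl (a * (c : ZMod p)) (b * ((c⁻¹ : (ZMod p)ˣ) : ZMod p))‖ ^ 4 ≤
      ∑ a : ZMod p, ∑ b : ZMod p, ‖kl a b‖ ^ 4 := by
    rw [← Finset.sum_product', Finset.univ_product_univ]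
    have hinj : Function.Injective
        (fun c : (ZMod p)ˣ => (a * (c : ZMod p), b * ((c⁻¹ : (ZMod p)ˣ) : ZMod p))) := by
      intro c d h
      simp only [Prod.mk.injEq] at h
      by_cases ha : a = 0
      · have hb : b ≠ 0 := fun hb => hab ⟨ha, hb⟩
        have := mul_left_cancel₀ hb h.2
        exact inv_injective (Units.ext this)
      · exact Units.ext (mul_left_cancel₀ ha h.1)
    rw [← Finset.sum_image (s := univ) (g := fun c : (ZMod p)ˣ => (a * (c : ZMod p), b * ((c⁻¹ : (ZMod p)ˣ) : ZMod p)))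
      (f := fun q : ZMod p × ZMod p => ‖kl q.1 q.2‖ ^ 4) (fun x _ y _ h => hinj h)]
    apply Finset.sum_le_sum_of_subset_of_nonneg (Finset.subset_univ _)
    intros; positivity
  simp_rw [kl_shift] at h1
  rw [Finset.sum_const, Finset.card_univ, ZMod.card_units_eq_totient,
    Nat.totient_prime (Fact.out : p.Prime), nsmul_eq_mul, Nat.cast_sub hp.le] at h1
  have h2 := h1.trans kl_fourth_sum
  have h3 : ((p : ℝ) - 1) * ‖kl a b‖ ^ 4 ≤ (p - 1) * (3 * (p - 1) * p ^ 2) := by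
    push_cast at h2
    linarith
  have h4 := le_of_mul_le_mul_left h3 (by linarith)
  nlinarith [sq_nonneg (p : ℝ)]

end chars

lemma kl_final (ε : ℝ) (hε : 0 < ε) : ∃ p₀ : ℕ, ∀ (p : ℕ) [Fact p.Prime], p ≥ p₀ →
    ∀ a b : ZMod p, ¬ (a = 0 ∧ b = 0) → ‖kl a b‖ ≤ ε * p := by
  refine ⟨⌈3 / ε ^ 4⌉₊, ?_⟩
  intro p _ hp a b hab
  have h1 : 3 / ε ^ 4 ≤ p := (Nat.le_ceil _).trans (by exact_mod_cast hp)
  rw [div_le_iff₀ (by positivity)] at h1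
  refine le_of_pow_le_pow_left₀ (n := 4) (by norm_num) (by positivity) ?_
  calc _ ≤ 3 * (p : ℝ) ^ 3 := kl_bound a b hab
    _ ≤ (p * ε ^ 4) * (p : ℝ) ^ 3 := by gcongr
    _ = _ := by ring
/-! ### Fourier expansions -/

section fourier
variable {p : ℕ} [Fact p.Prime]

/-- function with given Fourier coefficients -/
def fs (c : ZMod p → ℂ) (x : ZMod p) : ℂ := ∑ r, c r * ee (r * x)

lemma fs_mul (b c : ZMod p → ℂ) (x : ZMod p) :
    fs b x * fs c x = fs (fun t => ∑ r, b r * c (t - r)) x := by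
  unfold fs
  rw [Finset.sum_mul_sum]
  simp_rw [Finset.sum_mul]
  rw [Finset.sum_comm (s := univ) (t := univ) (f := fun t r => b r * c (t - r) * ee (t * x))]
  apply Finset.sum_congr rfl
  intro r _
  refine Fintype.sum_equiv (Equiv.addRight r) _ _ ?_
  intro s
  simp only [Equiv.coe_addRight, add_sub_cancel_right, add_mul, ee_add]
  ring

lemma fs_coeff (c : ZMod p → ℂ) (s : ZMod p) : ∑ x, fs c x * ee (-(s * x)) = p * c s := by
  unfold fs
  simp_rw [Finset.sum_mul]
  rw [Finset.sum_comm]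
  have : ∀ r, ∑ x, c r * ee (r * x) * ee (-(s * x)) = if r = s then p * c s else 0 := by
    intro r
    have h : ∀ x, c r * ee (r * x) * ee (-(s * x)) = c r * ee (x * (r - s)) := by
      intro x
      rw [mul_assoc, ← ee_add]; congr 2; ring
    simp_rw [h]
    rw [← Finset.mul_sum, sum_ee]
    by_cases hh : r = s
    · subst hh; simp [mul_comm]
    · simp [hh, sub_eq_zero]
  simp_rw [this]
  simp

lemma fs_sum (c : ZMod p → ℂ) : ∑ x, fs c x = p * c 0 := by
  rw [← fs_coeff]; simp [ee_zero]

lemma fs_single (s x : ZMod p) (a : ℂ) : fs (fun r => if r = s then a else 0) x = a * ee (s * x) := by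
  unfold fs
  simp

/-- nonnegative Fourier coefficients -/
def PD (f : ZMod p → ℂ) : Prop := ∃ b : ZMod p → ℝ, (∀ r, 0 ≤ b r) ∧ ∀ x, f x = fs (fun r => (b r : ℂ)) x

lemma PD.mul {f g : ZMod p → ℂ} (hf : PD f) (hg : PD g) : PD (fun x => f x * g x) := by
  obtain ⟨b, hb, hf⟩ := hf
  obtain ⟨c, hc, hg⟩ := hg
  refine ⟨fun t => ∑ r, b r * c (t - r), fun t => Finset.sum_nonneg fun r _ => mul_nonneg (hb _) (hc _), ?_⟩
  intro x
  beta_reduce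
  rw [hf, hg, fs_mul]
  push_cast; rfl

lemma PD.add {f g : ZMod p → ℂ} (hf : PD f) (hg : PD g) : PD (fun x => f x + g x) := by
  obtain ⟨b, hb, hf⟩ := hf
  obtain ⟨c, hc, hg⟩ := hg
  refine ⟨fun t => b t + c t, fun t => add_nonneg (hb _) (hc _), ?_⟩
  intro x
  beta_reduce
  rw [hf, hg]
  simp [fs, add_mul, Finset.sum_add_distrib]

lemma PD.char (s : ZMod p) (a : ℝ) (ha : 0 ≤ a) : PD (fun x => (a : ℂ) * ee (s * x)) := by
  refine ⟨fun r => if r = s then a else 0, fun r => by positivity, ?_⟩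
  intro x
  beta_reduce
  rw [← fs_single]
  congr 1
  ext r
  split_ifs <;> simp

lemma PD.const (a : ℝ) (ha : 0 ≤ a) : PD (fun _ : ZMod p => (a : ℂ)) := by
  simpa [ee_zero] using PD.char (p := p) 0 a ha

lemma PD.sum {ι : Type*} (s : Finset ι) (f : ι → ZMod p → ℂ) (h : ∀ i ∈ s, PD (f i)) :
    PD (fun x => ∑ i ∈ s, f i x) := by
  induction s using Finset.induction_on with
  | empty => simpa using PD.const (p := p) 0 le_rfl
  | insert a s ha ih =>
    simp_rw [Finset.sum_insert ha]
    exact PD.add (h _ (by simp)) (ih fun i hi => h i (by simp [hi]))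

lemma PD.prod {ι : Type*} (s : Finset ι) (f : ι → ZMod p → ℂ) (h : ∀ i ∈ s, PD (f i)) :
    PD (fun x => ∏ i ∈ s, f i x) := by
  induction s using Finset.induction_on with
  | empty => simpa using PD.const (p := p) 1 zero_le_one
  | insert a s ha ih =>
    simp_rw [Finset.prod_insert ha]
    exact PD.mul (h _ (by simp)) (ih fun i hi => h i (by simp [hi]))

lemma PD.mean {f : ZMod p → ℝ} (hf : PD (fun x => (f x : ℂ))) : 0 ≤ ∑ x, f x := by
  obtain ⟨b, hb, hf⟩ := hf
  have h : ((∑ x, f x : ℝ) : ℂ) = ((p * b 0 : ℝ) : ℂ) := by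
    push_cast
    simp_rw [hf]
    rw [fs_sum]
  rw [Complex.ofReal_injective h]
  have := hb 0
  positivity

/-- Fejér kernel -/
def fej (N : ℕ) (x : ZMod p) : ℝ := ‖∑ j ∈ range N, ee ((j : ZMod p) * x)‖ ^ 2 / N

lemma fej_nonneg (N : ℕ) (x : ZMod p) : 0 ≤ fej N x := by unfold fej; positivity

lemma fej_zero (N : ℕ) (hN : 0 < N) : fej N (0 : ZMod p) = N := by
  unfold fej
  simp [ee_zero]
  field_simp

lemma fej_expand (N : ℕ) (r x : ZMod p) : (fej N (r * x) : ℂ) =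
    ∑ q ∈ range N ×ˢ range N, ((1 / N : ℝ) : ℂ) * ee ((((q.1 : ZMod p) - (q.2 : ZMod p)) * r) * x) := by
  unfold fej
  push_cast
  rw [← Complex.mul_conj', map_sum, Finset.sum_mul_sum, ← Finset.sum_product', Finset.sum_div]
  apply Finset.sum_congr rfl
  intro q _
  rw [← ee_neg, ← ee_add, div_eq_mul_inv, mul_comm, one_div]
  congr 2
  ring

lemma fej_PD (N : ℕ) (r : ZMod p) : PD (fun x => (fej N (r * x) : ℂ)) := by
  rw [funext (fej_expand N r)]
  apply PD.sum
  intro q _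
  exact PD.char _ _ (by positivity)

lemma fej_sub_PD (N : ℕ) (hN : 0 < N) (r : ZMod p) : PD (fun x => ((fej N (r * x) - 1 : ℝ) : ℂ)) := by
  have : ∀ x, ((fej N (r * x) - 1 : ℝ) : ℂ) = ∑ q ∈ (range N ×ˢ range N).filter (fun q => q.1 ≠ q.2),
      ((1 / N : ℝ) : ℂ) * ee ((((q.1 : ZMod p) - (q.2 : ZMod p)) * r) * x) := by
    intro x
    push_cast
    rw [fej_expand, ← Finset.sum_filter_add_sum_filter_not _ (fun q : ℕ × ℕ => q.1 ≠ q.2)]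
    have h2 : ∑ q ∈ (range N ×ˢ range N).filter (fun q => ¬ q.1 ≠ q.2),
      ((1 / N : ℝ) : ℂ) * ee ((((q.1 : ZMod p) - (q.2 : ZMod p)) * r) * x) = 1 := by
      have h3 : ∀ q ∈ (range N ×ˢ range N).filter (fun q => ¬ q.1 ≠ q.2),
        ((1 / N : ℝ) : ℂ) * ee ((((q.1 : ZMod p) - (q.2 : ZMod p)) * r) * x) = ((1 / N : ℝ) : ℂ) := by
        intro q hq
        simp only [mem_filter, not_not] at hq
        rw [hq.2]; simp [ee_zero]
      rw [Finset.sum_congr rfl h3, Finset.sum_const]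
      have h4 : (range N ×ˢ range N).filter (fun q => ¬ q.1 ≠ q.2) = (range N).image (fun i => (i, i)) := by
        ext ⟨a, b⟩
        simp only [mem_filter, mem_product, mem_range, not_not, mem_image, Prod.mk.injEq]
        constructor
        · rintro ⟨⟨h, _⟩, h'⟩
          exact ⟨a, h, rfl, h'⟩
        · rintro ⟨i, h, rfl, rfl⟩
          exact ⟨⟨h, h⟩, rfl⟩
      rw [h4, Finset.card_image_of_injective _ (fun a b h => (Prod.mk.inj h).1)]
      have : (N : ℂ) ≠ 0 := by exact_mod_cast hN.ne'
      simp [this]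
    rw [h2]
    push_cast
    ring
  simp_rw [this]
  apply PD.sum
  intro q _
  exact PD.char _ _ (by positivity)

lemma fej_mul (N : ℕ) (hN : 0 < N) (x : ZMod p) : (1 - (ee x).re) * fej N x ≤ 2 / N := by
  have hN' : (0 : ℝ) < N := by exact_mod_cast hN
  have h1 : ‖ee x - 1‖ ^ 2 = 2 * (1 - (ee x).re) := by
    have h := norm_ee x
    have h2 : (ee x).re ^ 2 + (ee x).im ^ 2 = 1 := by
      have := Complex.sq_norm (ee x)
      rw [h, Complex.normSq_apply] at this
      linarith
    rw [Complex.sq_norm, Complex.normSq_apply]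
    simp
    linarith
  have hpow : ∀ j : ℕ, ee ((j : ZMod p) * x) = ee x ^ j := by
    intro j
    induction j with
    | zero => simp [ee_zero]
    | succ j ih => rw [pow_succ, ← ih, ← ee_add]; congr 1; push_cast; ring
  have h2 : (∑ j ∈ range N, ee ((j : ZMod p) * x)) * (ee x - 1) = ee x ^ N - 1 := by
    simp_rw [hpow]
    exact geom_sum_mul _ _
  have h3 : ‖ee x ^ N - 1‖ ≤ 2 := by
    refine (norm_sub_le _ _).trans ?_
    rw [norm_pow, norm_ee]; norm_num
  have h4 : ‖∑ j ∈ range N, ee ((j : ZMod p) * x)‖ ^ 2 * ‖ee x - 1‖ ^ 2 ≤ 4 := by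
    rw [← mul_pow, ← norm_mul, h2]
    nlinarith [norm_nonneg (ee x ^ N - 1)]
  unfold fej
  rw [← mul_div_assoc, div_le_div_iff_of_pos_right hN']
  rw [h1] at h4
  linarith

lemma exists_beta (R : Finset (ZMod p)) (N : ℕ) (hN : 0 < N) : ∃ (b β : ZMod p → ℝ),
    (∀ r, 0 ≤ b r) ∧ (∀ r, b r ≤ 1) ∧ b 0 = 1 ∧ (∀ r ∈ R, 1 - 2 / N ≤ b r) ∧ ∑ r, b r ≤ (N : ℝ) ^ R.card ∧
    (∀ x, 0 ≤ β x) ∧ (∀ x, (β x : ℂ) = fs (fun r => (b r : ℂ)) x) := by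
  have hp : (0 : ℝ) < p := by exact_mod_cast (Fact.out : p.Prime).pos
  have hpc : (p : ℂ) ≠ 0 := by exact_mod_cast hp.ne'
  let B : Finset (ZMod p) → ZMod p → ℝ := fun R x => ∏ r ∈ R, fej N (r * x)
  have hB0 : ∀ R x, 0 ≤ B R x := fun R x => Finset.prod_nonneg fun r _ => fej_nonneg _ _
  have hBPD : ∀ R, PD (fun x => (B R x : ℂ)) := by
    intro R
    simp only [B]
    push_cast
    exact PD.prod _ _ fun r _ => fej_PD N r
  have hins : ∀ (r) (R : Finset (ZMod p)), r ∉ R → ∀ x, B (insert r R) x = fej N (r * x) * B R x := by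
    intro r R hr x
    simp only [B]
    rw [Finset.prod_insert hr]
  have hmono : ∀ (r) (R : Finset (ZMod p)), r ∉ R → ∑ x, B R x ≤ ∑ x, B (insert r R) x := by
    intro r R hr
    have : PD (fun x => ((B (insert r R) x - B R x : ℝ) : ℂ)) := by
      have h := PD.mul (fej_sub_PD N hN r) (hBPD R)
      convert h using 2 with x
      rw [hins r R hr]; push_cast; ring
    have := PD.mean this
    rw [Finset.sum_sub_distrib] at this
    linarith
  have hge : ∀ R, (p : ℝ) ≤ ∑ x, B R x := by
    intro R
    induction R using Finset.induction_on with
    | empty => simp [B]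
    | insert r R hr ih => exact ih.trans (hmono r R hr)
  obtain ⟨b, hb, hB⟩ := hBPD R
  beta_reduce at hB
  have hsum : ∑ x, B R x = p * b 0 := by
    have h : ((∑ x, B R x : ℝ) : ℂ) = ((p * b 0 : ℝ) : ℂ) := by
      push_cast
      simp_rw [hB]
      rw [fs_sum]
    exact Complex.ofReal_injective h
  have hcoef : ∀ r, ∑ x, B R x * (ee (r * x)).re = p * b r := by
    intro r
    have h : ∑ x, (B R x : ℂ) * ee (-(r * x)) = p * b r := by
      simp_rw [hB]
      rw [fs_coeff]
    have := congrArg Complex.re h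
    rw [Complex.re_sum] at this
    simpa [ee_neg] using this
  have hM : 1 ≤ b 0 := by
    have := hge R
    rw [hsum] at this
    nlinarith
  have hM0 : 0 < b 0 := by linarith
  have htot : ∑ r, b r = (N : ℝ) ^ R.card := by
    have h := hB 0
    simp only [fs, mul_zero, ee_zero, mul_one, B, fej_zero N hN, Finset.prod_const] at h
    exact_mod_cast h.symm
  refine ⟨fun r => b r / b 0, fun x => B R x / b 0, ?_, ?_, ?_, ?_, ?_, ?_, ?_⟩
  · intro r; exact div_nonneg (hb r) hM0.le
  · intro r
    rw [div_le_one hM0]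
    have : (p : ℝ) * b r ≤ p * b 0 := by
      rw [← hcoef r, ← hsum]
      gcongr with x
      have h1 : (ee (r * x)).re ≤ 1 := (Complex.re_le_norm _).trans (norm_ee _).le
      nlinarith [hB0 R x]
    exact le_of_mul_le_mul_left this hp
  · exact div_self hM0.ne'
  · intro r hr
    rw [le_div_iff₀ hM0]
    have h1 : (p : ℝ) * b 0 - p * b r ≤ 2 / N * (p * b 0) := by
      rw [← hcoef r, ← hsum, ← Finset.sum_sub_distrib]
      have e : R = insert r (R.erase r) := (Finset.insert_erase hr).symm
      have hr' : r ∉ R.erase r := Finset.notMem_erase _ _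
      calc ∑ x, (B R x - B R x * (ee (r * x)).re) ≤ ∑ x, 2 / N * B (R.erase r) x := by
            gcongr with x
            have h2 := hins r _ hr' x
            rw [← e] at h2
            rw [h2]
            have h3 := fej_mul N hN (r * x)
            have h4 := mul_le_mul_of_nonneg_right h3 (hB0 (R.erase r) x)
            linarith
        _ = 2 / N * ∑ x, B (R.erase r) x := by rw [Finset.mul_sum]
        _ ≤ _ := by
            gcongr ?_ * ?_
            have := hmono r _ hr'
            rwa [← e] at this
    have h2 : (p : ℝ) * ((1 - 2 / N) * b 0) ≤ p * b r := by linarith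
    exact le_of_mul_le_mul_left h2 hp
  · rw [← Finset.sum_div, htot]
    exact div_le_self (by positivity) hM
  · intro x; exact div_nonneg (hB0 R x) hM0.le
  · intro x
    push_cast
    rw [hB]
    simp only [fs, Finset.sum_div]
    apply Finset.sum_congr rfl
    intro r _
    ring

/-- bounded Wiener norm -/
def Wi (C : ℝ) (f : ZMod p → ℂ) : Prop := ∃ c : ZMod p → ℂ, (∀ x, f x = fs c x) ∧ ∑ r, ‖c r‖ ≤ C

lemma Wi.mul {f g : ZMod p → ℂ} {C D : ℝ} (hf : Wi C f) (hg : Wi D g) (hC : 0 ≤ C) :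
    Wi (C * D) (fun x => f x * g x) := by
  obtain ⟨b, hf, hb⟩ := hf
  obtain ⟨c, hg, hc⟩ := hg
  refine ⟨fun t => ∑ r, b r * c (t - r), fun x => by beta_reduce; rw [hf, hg, fs_mul], ?_⟩
  calc ∑ t, ‖∑ r, b r * c (t - r)‖ ≤ ∑ t, ∑ r, ‖b r‖ * ‖c (t - r)‖ := by
        gcongr with t
        refine (norm_sum_le _ _).trans ?_
        simp
    _ = ∑ r, ‖b r‖ * ∑ t, ‖c (t - r)‖ := by
        rw [Finset.sum_comm]; simp_rw [Finset.mul_sum]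
    _ = ∑ r, ‖b r‖ * ∑ t, ‖c t‖ := by
        congr 1
        ext r
        congr 1
        exact Fintype.sum_equiv (Equiv.subRight r) _ _ (fun x => rfl)
    _ = (∑ r, ‖b r‖) * ∑ t, ‖c t‖ := by rw [Finset.sum_mul]
    _ ≤ C * D := by gcongr

lemma Wi.one : Wi 1 (fun _ : ZMod p => (1 : ℂ)) := by
  refine ⟨fun r => if r = 0 then 1 else 0, fun x => by rw [fs_single]; simp [ee_zero], ?_⟩
  have : ∀ r : ZMod p, ‖(if r = 0 then 1 else 0 : ℂ)‖ = if r = 0 then 1 else 0 := by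
    intro r; split_ifs <;> simp
  simp_rw [this]
  simp

lemma Wi.one_sub {f : ZMod p → ℂ} {C : ℝ} (hf : Wi C f) : Wi (1 + C) (fun x => 1 - f x) := by
  obtain ⟨b, hb, hb'⟩ := Wi.one (p := p)
  obtain ⟨c, hc, hc'⟩ := hf
  refine ⟨fun t => b t - c t, ?_, ?_⟩
  · intro x
    beta_reduce
    rw [hc]
    rw [show (1 : ℂ) = fs b x from hb x]
    simp [fs, sub_mul]
  · calc _ ≤ ∑ r, (‖b r‖ + ‖c r‖) := by gcongr with r; exact norm_sub_le _ _
      _ ≤ _ := by rw [Finset.sum_add_distrib]; gcongr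

lemma Wi.pow {f : ZMod p → ℂ} {C : ℝ} (hf : Wi C f) (hC : 0 ≤ C) (n : ℕ) :
    Wi (C ^ n) (fun x => f x ^ n) := by
  induction n with
  | zero => simpa using Wi.one
  | succ n ih =>
    simp_rw [pow_succ]
    exact ih.mul hf (by positivity)

lemma Wi.inv_sum {f : ZMod p → ℂ} {C : ℝ} (hf : Wi C f) (κ : ℝ) (hκ : 0 ≤ κ)
    (hK : ∀ a b : ZMod p, ¬ (a = 0 ∧ b = 0) → ‖kl a b‖ ≤ κ) :
    ‖∑ u : (ZMod p)ˣ, f (u : ZMod p) * f ((u⁻¹ : (ZMod p)ˣ) : ZMod p)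
      - ((p : ℂ) - 1) * ((∑ x, f x) / p) ^ 2‖ ≤ C ^ 2 * κ := by
  obtain ⟨c, hf, hc⟩ := hf
  have hpc : (p : ℂ) ≠ 0 := by exact_mod_cast (Fact.out : p.Prime).ne_zero
  have h0 : (∑ x, f x) / p = c 0 := by
    simp_rw [hf]; rw [fs_sum]; field_simp
  have h1 : ∑ u : (ZMod p)ˣ, f (u : ZMod p) * f ((u⁻¹ : (ZMod p)ˣ) : ZMod p)
      = ∑ q : ZMod p × ZMod p, c q.1 * c q.2 * kl q.1 q.2 := by
    have h2 : ∀ u : (ZMod p)ˣ, f (u : ZMod p) * f ((u⁻¹ : (ZMod p)ˣ) : ZMod p) =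
        ∑ q : ZMod p × ZMod p, c q.1 * ee (q.1 * (u : ZMod p)) *
          (c q.2 * ee (q.2 * ((u⁻¹ : (ZMod p)ˣ) : ZMod p))) := by
      intro u
      rw [hf, hf, fs, fs, Finset.sum_mul_sum, ← Finset.sum_product', Finset.univ_product_univ]
    simp_rw [h2]
    rw [Finset.sum_comm]
    apply Finset.sum_congr rfl
    intro q _
    rw [kl, Finset.mul_sum]
    apply Finset.sum_congr rfl
    intro u _
    rw [ee_add]; ring
  rw [h1, h0, ← Finset.add_sum_erase univ _ (Finset.mem_univ ((0, 0) : ZMod p × ZMod p))]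
  simp only [kl_zero]
  rw [show ∀ S : ℂ, c 0 * c 0 * ((p : ℂ) - 1) + S - (p - 1) * c 0 ^ 2 = S by intro S; ring]
  calc _ ≤ ∑ q ∈ univ.erase ((0, 0) : ZMod p × ZMod p), ‖c q.1‖ * ‖c q.2‖ * κ := by
        refine (norm_sum_le _ _).trans ?_
        gcongr with q hq
        rw [norm_mul, norm_mul]
        gcongr
        apply hK
        rintro ⟨h1, h2⟩
        exact (Finset.mem_erase.1 hq).1 (Prod.ext h1 h2)
    _ ≤ ∑ q : ZMod p × ZMod p, ‖c q.1‖ * ‖c q.2‖ * κ := by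
        apply Finset.sum_le_sum_of_subset_of_nonneg (Finset.subset_univ _)
        intros; positivity
    _ = (∑ r, ‖c r‖) ^ 2 * κ := by
        rw [← Finset.sum_mul, sq, Finset.sum_mul_sum, ← Finset.sum_product', Finset.univ_product_univ]
    _ ≤ _ := by gcongr

end fourier
/-! ### Granularization -/

section gran
variable {p : ℕ} [Fact p.Prime]

lemma fs_triple (c : ZMod p → ℂ) : ∑ x, ∑ y, fs c x * fs c y * fs c (x - y) =
    p ^ 2 * ∑ t, c t * c t * c (-t) := by
  have h1 : ∀ x y, fs c x * fs c y * fs c (x - y) =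
      ∑ t, c t * ((fs c x * ee (-((-t) * x))) * (fs c y * ee (-(t * y)))) := by
    intro x y
    rw [show fs c (x - y) = ∑ t, c t * ee (t * (x - y)) from rfl, Finset.mul_sum]
    apply Finset.sum_congr rfl
    intro t _
    rw [show t * (x - y) = -((-t) * x) + -(t * y) by ring, ee_add]
    ring
  simp_rw [h1]
  have h2 : ∀ x, ∑ y, ∑ t, c t * ((fs c x * ee (-((-t) * x))) * (fs c y * ee (-(t * y)))) =
      ∑ t, c t * (fs c x * ee (-((-t) * x))) * (p * c t) := by
    intro x
    rw [Finset.sum_comm]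
    apply Finset.sum_congr rfl
    intro t _
    rw [← fs_coeff, Finset.mul_sum]
    apply Finset.sum_congr rfl
    intro y _
    ring
  simp_rw [h2]
  rw [Finset.sum_comm, Finset.mul_sum]
  apply Finset.sum_congr rfl
  intro t _
  rw [← Finset.sum_mul, ← Finset.mul_sum, fs_coeff]
  ring

/-- Fourier coefficients of the indicator of `A` -/
def coA (A : Finset (ZMod p)) (r : ZMod p) : ℂ := (∑ y ∈ A, ee (-(r * y))) / p

lemma coA_neg (A : Finset (ZMod p)) (r : ZMod p) : coA A (-r) = (starRingEnd ℂ) (coA A r) := by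
  unfold coA
  rw [map_div₀, map_sum]
  simp [← ee_neg]

lemma fs_coA (A : Finset (ZMod p)) (x : ZMod p) : fs (coA A) x = if x ∈ A then 1 else 0 := by
  have hpc : (p : ℂ) ≠ 0 := by exact_mod_cast (Fact.out : p.Prime).ne_zero
  unfold fs coA
  have h : ∀ r, (∑ y ∈ A, ee (-(r * y))) / p * ee (r * x) = ∑ y ∈ A, ee (r * (x - y)) / p := by
    intro r
    rw [div_mul_eq_mul_div, Finset.sum_mul, Finset.sum_div]
    apply Finset.sum_congr rfl
    intro y _
    rw [← ee_add]
    congr 2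
    ring
  simp_rw [h]
  rw [Finset.sum_comm]
  simp_rw [← Finset.sum_div, sum_ee, sub_eq_zero]
  rw [Finset.sum_ite_eq]
  split_ifs <;> simp [hpc]

lemma coA_parseval (A : Finset (ZMod p)) : ∑ r, ‖coA A r‖ ^ 2 ≤ 1 := by
  have hp : (0 : ℝ) < p := by exact_mod_cast (Fact.out : p.Prime).pos
  have hpc : (p : ℂ) ≠ 0 := by exact_mod_cast (Fact.out : p.Prime).ne_zero
  have h : ((∑ r, ‖coA A r‖ ^ 2 : ℝ) : ℂ) = ((A.card / p : ℝ) : ℂ) := by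
    push_cast
    simp_rw [← Complex.mul_conj', ← coA_neg]
    have h1 : ∀ r, coA A r * coA A (-r) = (∑ y ∈ A, coA A r * ee (r * y)) / p := by
      intro r
      conv_lhs => rw [coA.eq_1 A (-r)]
      rw [← Finset.mul_sum]
      simp only [neg_mul, neg_neg]
      ring
    simp_rw [h1]
    rw [← Finset.sum_div, Finset.sum_comm]
    congr 1
    have : ∀ y ∈ A, ∑ r, coA A r * ee (r * y) = 1 := by
      intro y hy
      have := fs_coA A y
      rw [if_pos hy] at this
      exact this
    rw [Finset.sum_congr rfl this]
    simp
  rw [Complex.ofReal_injective h, div_le_one hp]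
  have := Finset.card_le_univ A
  rw [ZMod.card] at this
  exact_mod_cast this

lemma coA_norm_le (A : Finset (ZMod p)) (r : ZMod p) : ‖coA A r‖ ≤ 1 := by
  have h := coA_parseval A
  have h2 : ‖coA A r‖ ^ 2 ≤ 1 :=
    (Finset.single_le_sum (f := fun r => ‖coA A r‖ ^ 2) (fun i _ => by positivity) (mem_univ r)).trans h
  nlinarith [norm_nonneg (coA A r)]

lemma exists_gran (A : Finset (ZMod p)) (hA : A ∩ (A + A) = ∅) (N : ℕ) (hN : 0 < N) (δ : ℝ)
    (hδ : 0 < δ) : ∃ g : ZMod p → ℝ, (∀ x, 0 ≤ g x) ∧ (∀ x, g x ≤ 1) ∧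
      Wi ((N : ℝ) ^ ⌊1 / δ ^ 2⌋₊) (fun x => (g x : ℂ)) ∧
      ∑ x, ∑ y, g x * g y * g (x - y) ≤ (6 / N + δ) * p ^ 2 ∧
      ∀ η : ℝ, 0 ≤ η → ((A.filter (fun x => g x < η)).card : ℝ) ^ 2 ≤ η * p ^ 2 := by
  have hp : (0 : ℝ) < p := by exact_mod_cast (Fact.out : p.Prime).pos
  have hpc : (p : ℂ) ≠ 0 := by exact_mod_cast (Fact.out : p.Prime).ne_zero
  have hN' : (1 : ℝ) ≤ N := by exact_mod_cast hN
  set a := coA A with ha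
  set R : Finset (ZMod p) := univ.filter (fun r => δ ≤ ‖a r‖) with hR
  have hneg : ∀ t, ‖a (-t)‖ = ‖a t‖ := by
    intro t; rw [ha, coA_neg]; simp
  have hRcard : R.card ≤ ⌊1 / δ ^ 2⌋₊ := by
    apply Nat.le_floor
    rw [le_div_iff₀ (by positivity)]
    calc (R.card : ℝ) * δ ^ 2 = ∑ r ∈ R, δ ^ 2 := by simp
      _ ≤ ∑ r ∈ R, ‖a r‖ ^ 2 := by
          gcongr with r hr
          exact (Finset.mem_filter.1 hr).2
      _ ≤ ∑ r, ‖a r‖ ^ 2 := Finset.sum_le_sum_of_subset_of_nonneg (Finset.subset_univ _)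
          (by intros; positivity)
      _ ≤ 1 := coA_parseval A
  obtain ⟨b, β, hb0, hb1, hb00, hbR, hbs, hβ0, hβ⟩ := exists_beta R N hN
  have hβsum : ∑ x, β x = p := by
    have h : ((∑ x, β x : ℝ) : ℂ) = ((p : ℝ) : ℂ) := by
      push_cast
      simp_rw [hβ]
      rw [fs_sum, hb00]; simp
    exact Complex.ofReal_injective h
  let g : ZMod p → ℝ := fun x => (∑ y ∈ A, β (x - y)) / p
  have hg : ∀ x, (g x : ℂ) = fs (fun r => (b r : ℂ) * a r) x := by
    intro x
    simp only [g]
    push_cast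
    simp_rw [hβ, fs]
    rw [Finset.sum_comm, Finset.sum_div]
    apply Finset.sum_congr rfl
    intro r _
    rw [ha, coA, ← mul_div_assoc, div_mul_eq_mul_div]
    congr 1
    rw [Finset.mul_sum, Finset.sum_mul]
    apply Finset.sum_congr rfl
    intro y _
    rw [mul_assoc, ← ee_add]
    congr 2
    ring
  have hg0 : ∀ x, 0 ≤ g x := fun x => div_nonneg (Finset.sum_nonneg fun y _ => hβ0 _) hp.le
  refine ⟨g, hg0, ?_, ?_, ?_, ?_⟩
  · intro x
    simp only [g]
    rw [div_le_one hp, ← hβsum]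
    calc _ ≤ ∑ y, β (x - y) := Finset.sum_le_sum_of_subset_of_nonneg (Finset.subset_univ _)
            (by intros; exact hβ0 _)
      _ = _ := Fintype.sum_equiv (Equiv.subLeft x) _ _ (fun y => rfl)
  · refine ⟨_, hg, ?_⟩
    calc _ ≤ ∑ r, b r := by
          gcongr with r
          rw [norm_mul, Complex.norm_real, Real.norm_of_nonneg (hb0 r)]
          exact mul_le_of_le_one_right (hb0 r) (coA_norm_le A r)
      _ ≤ _ := hbs
      _ ≤ _ := pow_le_pow_right₀ hN' hRcard
  · have h0 : ∑ t, a t * a t * a (-t) = 0 := by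
      have h := fs_triple a
      have h1 : ∀ x y, fs a x * fs a y * fs a (x - y) = 0 := by
        intro x y
        rw [ha, fs_coA, fs_coA, fs_coA]
        by_cases hx : x ∈ A <;> by_cases hy : y ∈ A <;> by_cases hz : x - y ∈ A <;> simp [hx, hy, hz]
        have : x ∈ A ∩ (A + A) := by
          rw [Finset.mem_inter]
          refine ⟨hx, ?_⟩
          rw [Finset.mem_add]
          exact ⟨y, hy, x - y, hz, by ring⟩
        rw [hA] at this
        simp at this
      simp_rw [h1] at h
      simp only [sum_const_zero] at h
      have := mul_eq_zero.1 h.symm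
      rcases this with h2 | h2
      · exact absurd h2 (by simpa using hpc)
      · exact h2
    have h1 : ((∑ x, ∑ y, g x * g y * g (x - y) : ℝ) : ℂ) =
        p ^ 2 * ∑ t, (a t * a t * a (-t)) * ((b t * b t * b (-t) - 1 : ℝ) : ℂ) := by
      push_cast
      simp_rw [hg]
      rw [fs_triple]
      congr 1
      simp_rw [mul_sub, mul_one]
      rw [Finset.sum_sub_distrib, h0, sub_zero]
      apply Finset.sum_congr rfl
      intro t _
      ring
    have h2 : ‖((∑ x, ∑ y, g x * g y * g (x - y) : ℝ) : ℂ)‖ ≤ (6 / N + δ) * p ^ 2 := by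
      rw [h1, norm_mul, norm_pow, Complex.norm_natCast, mul_comm]
      gcongr
      calc _ ≤ ∑ t, ‖a t‖ ^ 2 * (6 / N + δ) := by
            refine (norm_sum_le _ _).trans ?_
            gcongr with t
            rw [norm_mul, norm_mul, norm_mul, hneg, Complex.norm_real, Real.norm_eq_abs]
            have c0 := hb0 t
            have c1 := hb1 t
            have d0 := hb0 (-t)
            have d1 := hb1 (-t)
            have e0 : 0 ≤ b t * b t * b (-t) := by positivity
            have e1 : b t * b t * b (-t) ≤ 1 :=
              mul_le_one₀ (mul_le_one₀ c1 c0 c1) d0 d1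
            have habs : |b t * b t * b (-t) - 1| = 1 - b t * b t * b (-t) := by
              rw [abs_of_nonpos (by linarith)]; ring
            rw [habs, sq, mul_assoc]
            refine mul_le_mul_of_nonneg_left ?_ (by positivity)
            have hn : (0 : ℝ) ≤ 6 / N := by positivity
            by_cases ht : δ ≤ ‖a t‖
            · have r1 := hbR t (by simp [hR, ht])
              have r2 := hbR (-t) (by simp [hR, hneg, ht])
              have hn1 : ‖a t‖ ≤ 1 := coA_norm_le A t
              have q1 : b t * b t ≥ 1 - 2 * (2 / N) := by nlinarith
              have q2 : b t * b t * b (-t) ≥ 1 - 3 * (2 / N) := by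
                have : b t * b t ≤ 1 := mul_le_one₀ c1 c0 c1
                nlinarith
              have q3 : 1 - b t * b t * b (-t) ≤ 6 / N := by
                rw [show (6 : ℝ) / N = 3 * (2 / N) by ring]; linarith
              nlinarith [norm_nonneg (a t)]
            · push Not at ht
              nlinarith [norm_nonneg (a t)]
        _ = (∑ t, ‖a t‖ ^ 2) * (6 / N + δ) := by rw [Finset.sum_mul]
        _ ≤ 1 * (6 / N + δ) := by gcongr; exact coA_parseval A
        _ = _ := one_mul _
    rw [Complex.norm_real] at h2
    exact (Real.le_norm_self _).trans h2
  · intro η hη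
    set D := A.filter (fun x => g x < η) with hD
    have h1 : ∑ x ∈ D, ∑ y ∈ D, β (x - y) ≤ η * p ^ 2 := by
      calc _ ≤ ∑ x ∈ D, η * p := by
            gcongr with x hx
            have h2 := (Finset.mem_filter.1 hx).2
            simp only [g] at h2
            rw [div_lt_iff₀ hp] at h2
            refine le_trans ?_ h2.le
            exact Finset.sum_le_sum_of_subset_of_nonneg (Finset.filter_subset _ _)
              (by intros; exact hβ0 _)
        _ = D.card * (η * p) := by simp
        _ ≤ p * (η * p) := by
            gcongr
            have := Finset.card_le_univ D
            rw [ZMod.card] at this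
            exact_mod_cast this
        _ = _ := by ring
    refine le_trans ?_ h1
    have h2 : ((∑ x ∈ D, ∑ y ∈ D, β (x - y) : ℝ) : ℂ) =
        ((∑ r, b r * ‖∑ x ∈ D, ee (r * x)‖ ^ 2 : ℝ) : ℂ) := by
      push_cast
      simp_rw [hβ, fs, ← Complex.mul_conj', map_sum, Finset.sum_mul_sum, Finset.mul_sum]
      rw [Finset.sum_comm (s := univ)]
      apply Finset.sum_congr rfl
      intro x _
      rw [Finset.sum_comm (s := univ)]
      apply Finset.sum_congr rfl
      intro y _
      apply Finset.sum_congr rfl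
      intro r _
      rw [mul_sub, ee_sub]
    rw [Complex.ofReal_injective h2]
    have h3 := Finset.single_le_sum (f := fun r => b r * ‖∑ x ∈ D, ee (r * x)‖ ^ 2)
      (fun i _ => mul_nonneg (hb0 i) (by positivity)) (mem_univ 0)
    simpa [hb00, ee_zero] using h3

end gran
lemma schur_le_sum {p : ℕ} [Fact p.Prime] (g : ZMod p → ℝ) (hg : ∀ x, 0 ≤ g x) (θ : ℝ) (hθ : 0 < θ) :
    (schur (univ.filter (fun x => θ ≤ g x)) : ℝ) * θ ^ 3 ≤ ∑ x, ∑ y, g x * g y * g (x - y) := by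
  set S := univ.filter (fun x => θ ≤ g x) with hS
  have hmem : ∀ x, x ∈ S ↔ θ ≤ g x := by intro x; simp [hS]
  unfold schur repr2
  push_cast
  rw [Finset.sum_mul]
  calc _ ≤ ∑ x ∈ S, ∑ y, g x * g y * g (x - y) := by
        gcongr with x hx
        calc _ = ∑ y ∈ S.filter (fun a => x - a ∈ S), θ ^ 3 := by simp
          _ ≤ ∑ y ∈ S.filter (fun a => x - a ∈ S), g x * g y * g (x - y) := by
              apply Finset.sum_le_sum
              intro y hy
              rw [Finset.mem_filter, hmem, hmem] at hy
              rw [hmem] at hx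
              have := hg x
              have := hg y
              calc θ ^ 3 = θ * θ * θ := by ring
                _ ≤ _ := by gcongr; exacts [hy.1, hy.2]
          _ ≤ _ := Finset.sum_le_sum_of_subset_of_nonneg (Finset.subset_univ _)
              (fun y _ _ => mul_nonneg (mul_nonneg (hg _) (hg _)) (hg _))
    _ ≤ _ := Finset.sum_le_sum_of_subset_of_nonneg (Finset.subset_univ _)
        (fun x _ _ => Finset.sum_nonneg fun y _ => mul_nonneg (mul_nonneg (hg _) (hg _)) (hg _))

set_option maxHeartbeats 1000000 in
lemma main_bound (ε : ℝ) (hε : 0 < ε) (hε1 : ε ≤ 1 / 10) :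
    ∃ p₀ : ℕ, ∀ (p : ℕ) [Fact p.Prime], p ≥ p₀ →
      ∀ A : Finset (ZMod p), (0 : ZMod p) ∉ A →
        A ∩ (A + A) = ∅ → inv' A = A →
          (A.card : ℝ) ≤ (1 / 9 + 11 * ε) * p := by
  obtain ⟨κ, hκ, p₁, hschur⟩ := schur_final ε hε hε1
  have hη1 : 1 - ε ^ 2 < 1 := by nlinarith
  have hη0 : 0 ≤ 1 - ε ^ 2 := by nlinarith
  obtain ⟨n', hn'⟩ := exists_pow_lt_of_lt_one hε hη1
  set n := n' + 1 with hn
  have hnp : (0 : ℝ) < n := by positivity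
  have hpow : (1 - ε ^ 2) ^ n ≤ ε := by
    rw [hn, pow_succ]
    have : 0 ≤ (1 - ε ^ 2) ^ n' := by positivity
    nlinarith
  set θ : ℝ := ε / n with hθ
  have hθ0 : 0 < θ := by positivity
  set δ : ℝ := κ * θ ^ 3 / 2 with hδ
  have hδ0 : 0 < δ := by positivity
  obtain ⟨N', hN'⟩ := exists_nat_gt (6 / δ)
  set N := N' + 1 with hN
  have hNd : 6 / (N : ℝ) ≤ δ := by
    rw [div_le_iff₀ (by positivity)]
    rw [div_lt_iff₀ hδ0] at hN'
    push_cast [hN]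
    nlinarith
  set C : ℝ := 1 + (1 + (N : ℝ) ^ ⌊1 / δ ^ 2⌋₊) ^ n with hC
  have hC0 : 0 < C := by positivity
  obtain ⟨p₂, hkl⟩ := kl_final (ε / C ^ 2) (by positivity)
  refine ⟨max p₁ p₂, ?_⟩
  intro p _ hp A hA0 hAs hAi
  have hpp : (0 : ℝ) < p := by exact_mod_cast (Fact.out : p.Prime).pos
  have hp1 : (1 : ℝ) ≤ p := by exact_mod_cast (Fact.out : p.Prime).one_lt.le
  obtain ⟨g, hg0, hg1, hgW, hgT, hgD⟩ := exists_gran A hAs N (by omega) δ hδ0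
  -- the polynomial approximation to the indicator of a level set
  let h : ZMod p → ℝ := fun x => 1 - (1 - g x) ^ n
  have hh0 : ∀ x, 0 ≤ h x := fun x => by
    have := pow_le_one₀ (n := n) (sub_nonneg.2 (hg1 x)) (by linarith [hg0 x])
    simp only [h]; linarith
  have hh1 : ∀ x, h x ≤ 1 := fun x => by
    have := pow_nonneg (sub_nonneg.2 (hg1 x)) n
    simp only [h]; linarith
  have hhg : ∀ x, h x ≤ n * g x := fun x => by
    have := one_add_mul_le_pow (a := - g x) (by linarith [hg1 x]) n
    rw [← sub_eq_add_neg 1 (g x)] at this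
    simp only [h]; linarith
  have hhW : Wi C (fun x => (h x : ℂ)) := by
    have := ((hgW.one_sub).pow (by positivity) n).one_sub
    convert this using 2 with x
    simp only [h]; push_cast; ring
  -- the sum of h
  set S := univ.filter (fun x => θ ≤ g x) with hS
  have hScard : (S.card : ℝ) ≤ (1 / 3 + ε) * p := by
    apply hschur p ((le_max_left _ _).trans hp)
    have h1 := (schur_le_sum g hg0 θ hθ0).trans hgT
    have h2 : (6 / (N : ℝ) + δ) * p ^ 2 ≤ (κ * p ^ 2) * θ ^ 3 := by
      have : 6 / (N : ℝ) + δ ≤ κ * θ ^ 3 := by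
        have : κ * θ ^ 3 = 2 * δ := by rw [hδ]; ring
        linarith
      calc _ ≤ (κ * θ ^ 3) * p ^ 2 := by gcongr
        _ = _ := by ring
    exact le_of_mul_le_mul_right (h1.trans h2) (by positivity)
  have hsum : ∑ x, h x ≤ (1 / 3 + 2 * ε) * p := by
    calc ∑ x, h x ≤ ∑ x, ((if x ∈ S then 1 else 0) + ε) := by
          gcongr with x
          split_ifs with hx
          · linarith [hh1 x]
          · have h2 : g x < θ := by
              by_contra hcon
              exact hx (by simp [hS]; linarith)
            have h3 : (n : ℝ) * g x ≤ n * θ := by gcongr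
            have h4 : (n : ℝ) * θ = ε := by rw [hθ]; field_simp
            linarith [hhg x]
      _ = S.card + p * ε := by
          rw [Finset.sum_add_distrib]
          simp [ZMod.card]
      _ ≤ _ := by linarith
  have hsum0 : 0 ≤ ∑ x, h x := Finset.sum_nonneg fun x _ => hh0 x
  -- equidistribution
  have heq := hhW.inv_sum (ε / C ^ 2 * p) (by positivity) (hkl p ((le_max_right _ _).trans hp))
  have heq2 : ∑ u : (ZMod p)ˣ, h (u : ZMod p) * h ((u⁻¹ : (ZMod p)ˣ) : ZMod p)
      ≤ (1 / 3 + 2 * ε) ^ 2 * p + ε * p := by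
    have e1 : C ^ 2 * (ε / C ^ 2 * p) = ε * p := by field_simp
    rw [e1] at heq
    have e2 : ‖((∑ u : (ZMod p)ˣ, h (u : ZMod p) * h ((u⁻¹ : (ZMod p)ˣ) : ZMod p)
      - ((p : ℝ) - 1) * ((∑ x, h x) / p) ^ 2 : ℝ) : ℂ)‖ ≤ ε * p := by
      simp only [Complex.ofReal_sub, Complex.ofReal_sum, Complex.ofReal_mul, Complex.ofReal_pow,
        Complex.ofReal_div, Complex.ofReal_natCast, Complex.ofReal_one]
      exact heq
    rw [Complex.norm_real] at e2
    have e3 := (Real.le_norm_self _).trans e2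
    have e4 : (∑ x, h x) / p ≤ 1 / 3 + 2 * ε := by
      rw [div_le_iff₀ hpp]; exact hsum
    have e5 : ((∑ x, h x) / p) ^ 2 ≤ (1 / 3 + 2 * ε) ^ 2 := by
      gcongr
    have e6 : ((p : ℝ) - 1) * ((∑ x, h x) / p) ^ 2 ≤ p * (1 / 3 + 2 * ε) ^ 2 := by
      gcongr
      linarith
    linarith
  -- lower bound
  set D := A.filter (fun x => g x < ε ^ 2) with hD
  have hDc : (D.card : ℝ) ≤ ε * p := by
    have := hgD (ε ^ 2) (by positivity)
    rw [← mul_pow] at this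
    exact le_of_pow_le_pow_left₀ two_ne_zero (by positivity) this
  set E := A \ (D ∪ inv' D) with hE
  have hEc : (A.card : ℝ) ≤ E.card + 2 * ε * p := by
    have h1 : A.card ≤ E.card + (D ∪ inv' D).card := by
      have := Finset.le_card_sdiff (D ∪ inv' D) A
      rw [← hE] at this
      omega
    have h2 := Finset.card_union_le D (inv' D)
    have h3 : (inv' D).card ≤ D.card := Finset.card_image_le
    have h4 : (A.card : ℝ) ≤ E.card + (D.card + D.card) := by
      exact_mod_cast (by omega : A.card ≤ E.card + (D.card + D.card))
    linarith
  have hlow : ∀ x ∈ A, x ∉ D → 1 - ε ≤ h x := by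
    intro x hx hxD
    have h1 : ε ^ 2 ≤ g x := by
      by_contra hcon
      exact hxD (Finset.mem_filter.2 ⟨hx, by linarith⟩)
    have h2 : (1 - g x) ^ n ≤ (1 - ε ^ 2) ^ n := by
      have := hg1 x
      gcongr
    simp only [h]; linarith
  have hEh : ∀ x ∈ E, (1 - ε) ^ 2 ≤ h x * h x⁻¹ := by
    intro x hx
    simp only [hE, mem_sdiff, mem_union, not_or] at hx
    have hxi : x⁻¹ ∈ A := by
      rw [← hAi]; exact Finset.mem_image_of_mem _ hx.1
    have hxiD : x⁻¹ ∉ D := by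
      intro hh
      apply hx.2.2
      exact Finset.mem_image.2 ⟨x⁻¹, hh, inv_inv x⟩
    have h1 := hlow x hx.1 hx.2.1
    have h2 := hlow _ hxi hxiD
    rw [sq]
    have : 0 ≤ 1 - ε := by linarith
    have := hh0 x
    gcongr
  have hE0 : ∀ x ∈ E, x ≠ 0 := by
    rintro x hx rfl
    exact hA0 (Finset.mem_sdiff.1 hx).1
  have hunits : (E.card : ℝ) * (1 - ε) ^ 2 ≤
      ∑ u : (ZMod p)ˣ, h (u : ZMod p) * h ((u⁻¹ : (ZMod p)ˣ) : ZMod p) := by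
    set U : Finset (ZMod p)ˣ := univ.filter (fun u => (u : ZMod p) ∈ E) with hU
    have hUE : E.card ≤ U.card := by
      have : E ⊆ U.image (fun u : (ZMod p)ˣ => (u : ZMod p)) := by
        intro x hx
        exact Finset.mem_image.2 ⟨Units.mk0 x (hE0 x hx), by simp [hU, hx], rfl⟩
      exact (Finset.card_le_card this).trans Finset.card_image_le
    calc _ ≤ (U.card : ℝ) * (1 - ε) ^ 2 := by gcongr
      _ = ∑ u ∈ U, (1 - ε) ^ 2 := by simp
      _ ≤ ∑ u ∈ U, h (u : ZMod p) * h ((u⁻¹ : (ZMod p)ˣ) : ZMod p) := by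
          gcongr with u hu
          rw [Units.val_inv_eq_inv_val]
          exact hEh _ (Finset.mem_filter.1 hu).2
      _ ≤ _ := Finset.sum_le_sum_of_subset_of_nonneg (Finset.subset_univ _)
          (fun u _ _ => mul_nonneg (hh0 _) (hh0 _))
  have hEp : (E.card : ℝ) ≤ p := by
    have := Finset.card_le_univ E
    rw [ZMod.card] at this
    exact_mod_cast this
  have f1 : (E.card : ℝ) - 2 * ε * p ≤ E.card * (1 - ε) ^ 2 := by
    have : ε * (E.card : ℝ) ≤ ε * p := by gcongr
    have : 0 ≤ ε ^ 2 * (E.card : ℝ) := by positivity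
    nlinarith
  have f2 : (A.card : ℝ) ≤ ((1 / 3 + 2 * ε) ^ 2 + 5 * ε) * p := by linarith
  refine f2.trans ?_
  refine mul_le_mul_of_nonneg_right ?_ hpp.le
  nlinarith

/-- A sum-free set `A ⊆ 𝔽_p^*` with `A = A*` satisfies `|A| ≤ (1/9 + o(1))·p`. -/
theorem sumFree_self_inverse_card_bound :
    ∀ ε : ℝ, ε > 0 → ∃ p₀ : ℕ, ∀ (p : ℕ) [Fact p.Prime], p ≥ p₀ →
      ∀ A : Finset (ZMod p), (0 : ZMod p) ∉ A →
        A ∩ (A + A) = ∅ → inv' A = A →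
          (A.card : ℝ) ≤ (1 / 9 + ε) * p := by
  intro ε hε
  obtain ⟨p₀, h⟩ := main_bound (min (ε / 11) (1 / 10)) (by positivity) (min_le_right _ _)
  refine ⟨p₀, ?_⟩
  intro p _ hp A h0 h1 h2
  refine (h p hp A h0 h1 h2).trans ?_
  have := min_le_left (ε / 11) (1 / 10)
  gcongr
  linarith
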